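/- Let A and B be normal fanning frames such that for every t ∈ ℝ the span of the columns of A(t) equals the span of the columns of B(t) (as subspaces of ℝ^{kn}). Then there exists a constant invertible n×n real matrix X such that B(t) = A(t)X for all t. -/

import Mathlib

open Matrix

noncomputable def mderiv {M N : ℕ} (A : ℝ → Matrix (Fin M) (Fin N) ℝ) :
    ℝ → Matrix (Fin M) (Fin N) ℝ :=
  fun t => Matrix.of fun i j => deriv (fun s => A s i j) t

noncomputable def dmat {M N : ℕ} (i : ℕ) (A : ℝ → Matrix (Fin M) (Fin N) ℝ) :
    ℝ → Matrix (Fin M) (Fin N) ℝ :=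
  mderiv^[i] A

def MatSmooth {M N : ℕ} (A : ℝ → Matrix (Fin M) (Fin N) ℝ) : Prop :=
  ∀ i j, ContDiff ℝ (⊤ : ℕ∞) fun t => A t i j

def juxt (k n : ℕ) (B : Fin k → Matrix (Fin (k * n)) (Fin n) ℝ) :
    Matrix (Fin (k * n)) (Fin (k * n)) ℝ :=
  Matrix.of fun r c => B (finProdFinEquiv.symm c).1 r (finProdFinEquiv.symm c).2

noncomputable def frameMat (k n : ℕ) (A : ℝ → Matrix (Fin (k * n)) (Fin n) ℝ) (t : ℝ) :
    Matrix (Fin (k * n)) (Fin (k * n)) ℝ :=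
  juxt k n fun i => dmat (i : ℕ) A t

def IsFanning (k n : ℕ) (A : ℝ → Matrix (Fin (k * n)) (Fin n) ℝ) : Prop :=
  MatSmooth A ∧ ∀ t, IsUnit (frameMat k n A t)

def IsCoeffs (k n : ℕ) (A : ℝ → Matrix (Fin (k * n)) (Fin n) ℝ)
    (P : ℕ → ℝ → Matrix (Fin n) (Fin n) ℝ) : Prop :=
  (∀ i ∈ Finset.Icc 1 k, MatSmooth (P i)) ∧
  ∀ t, dmat k A t + ∑ i ∈ Finset.Icc 1 k, (k.choose i : ℝ) • (dmat (k - i) A t * P i t) = 0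

lemma dmat_apply {M N : ℕ} (i : ℕ) (A : ℝ → Matrix (Fin M) (Fin N) ℝ) (t : ℝ)
    (r : Fin M) (c : Fin N) :
    dmat i A t r c = iteratedDeriv i (fun s => A s r c) t := by
  induction i generalizing t with
  | zero => simp [dmat]
  | succ i ih =>
    have h : dmat (i + 1) A t r c = deriv (fun s => dmat i A s r c) t := by
      simp only [dmat, Function.iterate_succ_apply', mderiv, Matrix.of_apply]
    rw [h, iteratedDeriv_succ]
    congr 1
    exact funext ih

lemma MatSmooth.dmat {M N : ℕ} {A : ℝ → Matrix (Fin M) (Fin N) ℝ} (hA : MatSmooth A) (i : ℕ) :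
    MatSmooth (dmat i A) := by
  intro r c
  simp only [dmat_apply, iteratedDeriv_eq_iterate]
  exact (hA r c).iterate_deriv i

lemma MatSmooth.mul {M N K : ℕ} {A : ℝ → Matrix (Fin M) (Fin N) ℝ}
    {B : ℝ → Matrix (Fin N) (Fin K) ℝ} (hA : MatSmooth A) (hB : MatSmooth B) :
    MatSmooth fun t => A t * B t := by
  intro r c
  simp only [Matrix.mul_apply]
  exact ContDiff.sum fun l _ => (hA r l).mul (hB l c)

lemma MatSmooth.det {N : ℕ} {A : ℝ → Matrix (Fin N) (Fin N) ℝ} (hA : MatSmooth A) :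
    ContDiff ℝ (⊤ : ℕ∞) fun t => (A t).det := by
  simp only [Matrix.det_apply']
  exact ContDiff.sum fun σ _ => contDiff_const.mul (contDiff_prod fun i _ => hA _ _)

lemma MatSmooth.adjugate {N : ℕ} {A : ℝ → Matrix (Fin N) (Fin N) ℝ} (hA : MatSmooth A) :
    MatSmooth fun t => (A t).adjugate := by
  intro r c
  simp only [Matrix.adjugate_apply]
  refine MatSmooth.det fun i j => ?_
  by_cases h : i = c
  · subst h
    simpa using contDiff_const
  · simpa [Matrix.updateRow_ne h] using hA i j

lemma MatSmooth.inv {N : ℕ} {A : ℝ → Matrix (Fin N) (Fin N) ℝ} (hA : MatSmooth A)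
    (hu : ∀ t, IsUnit (A t)) : MatSmooth fun t => (A t)⁻¹ := by
  intro r c
  simp only [Matrix.inv_def, Matrix.smul_apply, Ring.inverse_eq_inv', smul_eq_mul]
  exact (hA.det.inv fun t => ((Matrix.isUnit_iff_isUnit_det _).1 (hu t)).ne_zero).mul
    (hA.adjugate r c)

/-- The Leibniz rule for matrix products. -/
lemma dmat_mul {M N K : ℕ} {A : ℝ → Matrix (Fin M) (Fin N) ℝ}
    {X : ℝ → Matrix (Fin N) (Fin K) ℝ} (hA : MatSmooth A) (hX : MatSmooth X) (m : ℕ) (t : ℝ) :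
    dmat m (fun s => A s * X s) t =
      ∑ i ∈ Finset.range (m + 1), (m.choose i : ℝ) • (dmat i A t * dmat (m - i) X t) := by
  have hle : ((m : ℕ∞) : WithTop ℕ∞) ≤ ((⊤ : ℕ∞) : WithTop ℕ∞) := by exact_mod_cast le_top
  ext r c
  simp only [dmat_apply, Matrix.mul_apply, Matrix.sum_apply, Matrix.smul_apply, smul_eq_mul]
  rw [iteratedDeriv_fun_sum fun l _ => (((hA r l).mul (hX l c)).of_le hle).contDiffAt]
  simp only [Finset.mul_sum]
  rw [Finset.sum_comm]
  refine Finset.sum_congr rfl fun l _ => ?_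
  rw [iteratedDeriv_fun_mul ((hA r l).of_le hle).contDiffAt ((hX l c).of_le hle).contDiffAt]
  exact Finset.sum_congr rfl fun i _ => mul_assoc _ _ _

/-- The `i`-th block of `n` rows of the inverse of the frame matrix. -/
noncomputable def dualBlock (k n : ℕ) (A : ℝ → Matrix (Fin (k * n)) (Fin n) ℝ) (i : Fin k)
    (t : ℝ) : Matrix (Fin n) (Fin (k * n)) ℝ :=
  Matrix.of fun r c => (frameMat k n A t)⁻¹ (finProdFinEquiv (i, r)) c

lemma IsFanning.dualBlock_mul {k n : ℕ} {A : ℝ → Matrix (Fin (k * n)) (Fin n) ℝ}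
    (hA : IsFanning k n A) (i j : Fin k) (t : ℝ) :
    dualBlock k n A i t * dmat (j : ℕ) A t = if i = j then 1 else 0 := by
  have h : (frameMat k n A t)⁻¹ * frameMat k n A t = 1 :=
    Matrix.nonsing_inv_mul _ ((Matrix.isUnit_iff_isUnit_det _).1 (hA.2 t))
  ext r c
  have h' := congrFun (congrFun h (finProdFinEquiv (i, r))) (finProdFinEquiv (j, c))
  simp only [Matrix.mul_apply, frameMat, juxt, Matrix.of_apply, Equiv.symm_apply_apply,
    Matrix.one_apply, EmbeddingLike.apply_eq_iff_eq, Prod.mk.injEq] at h'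
  simp only [Matrix.mul_apply, dualBlock, frameMat, juxt, Matrix.of_apply]
  rw [h']
  by_cases hij : i = j <;> simp [hij, Matrix.one_apply]

lemma IsFanning.matSmooth_dualBlock {k n : ℕ} {A : ℝ → Matrix (Fin (k * n)) (Fin n) ℝ}
    (hA : IsFanning k n A) (i : Fin k) : MatSmooth (dualBlock k n A i) := by
  have hF : MatSmooth (frameMat k n A) := fun r c => hA.1.dmat _ _ _
  exact fun r c => hF.inv hA.2 _ _

lemma exists_eq_mul_of_range_le {M N K : ℕ} {A : Matrix (Fin M) (Fin N) ℝ}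
    {B : Matrix (Fin M) (Fin K) ℝ}
    (h : LinearMap.range B.mulVecLin ≤ LinearMap.range A.mulVecLin) :
    ∃ X : Matrix (Fin N) (Fin K) ℝ, B = A * X := by
  have h' : ∀ j, ∃ v, A *ᵥ v = B.col j := fun j => by
    obtain ⟨v, hv⟩ := h ⟨Pi.single j 1, rfl⟩
    exact ⟨v, by simpa using hv⟩
  choose v hv using h'
  refine ⟨Matrix.of fun r c => v c r, ?_⟩
  ext r c
  exact (congrFun (hv c) r).symm

lemma IsFanning.eq_mul_dualBlock_mul {k n K : ℕ} {A : ℝ → Matrix (Fin (k * n)) (Fin n) ℝ}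
    {B : ℝ → Matrix (Fin (k * n)) (Fin K) ℝ} (hA : IsFanning k n A) (hk : 0 < k) {t : ℝ}
    (h : LinearMap.range (B t).mulVecLin ≤ LinearMap.range (A t).mulVecLin) :
    B t = A t * (dualBlock k n A ⟨0, hk⟩ t * B t) := by
  obtain ⟨X, hX⟩ := exists_eq_mul_of_range_le h
  have h0 : dualBlock k n A ⟨0, hk⟩ t * A t = 1 := by
    simpa [dmat] using hA.dualBlock_mul ⟨0, hk⟩ ⟨0, hk⟩ t
  rw [hX, ← Matrix.mul_assoc (dualBlock k n A ⟨0, hk⟩ t), h0, Matrix.one_mul]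

/-- If `L` annihilates `A, …, A^{(k-2)}` at `t` and the frame is normal, then `L` annihilates
`A^{(k)}` at `t`. -/
lemma IsCoeffs.mul_dmat_eq_zero {k n K : ℕ} {A : ℝ → Matrix (Fin (k * n)) (Fin n) ℝ}
    {P : ℕ → ℝ → Matrix (Fin n) (Fin n) ℝ} (hP : IsCoeffs k n A P) {t : ℝ} (hP1 : P 1 t = 0)
    {L : Matrix (Fin K) (Fin (k * n)) ℝ} (hL : ∀ j, j + 1 < k → L * dmat j A t = 0) :
    L * dmat k A t = 0 := by
  rw [eq_neg_of_add_eq_zero_left (hP.2 t), Matrix.mul_neg, neg_eq_zero, Matrix.mul_sum]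
  refine Finset.sum_eq_zero fun i hi => ?_
  rw [Finset.mem_Icc] at hi
  rcases eq_or_ne i 1 with rfl | h1
  · simp [hP1]
  · rw [Matrix.mul_smul, ← Matrix.mul_assoc, hL _ (by omega), Matrix.zero_mul, smul_zero]

/-- Two normal frames spanning the same fanning curve differ by a
constant invertible `n × n` matrix. -/
theorem stmt_3 (k n : ℕ) (hk : 2 ≤ k) (hn : 1 ≤ n)
    (A B : ℝ → Matrix (Fin (k * n)) (Fin n) ℝ)
    (hA : IsFanning k n A) (hB : IsFanning k n B)
    (PA PB : ℕ → ℝ → Matrix (Fin n) (Fin n) ℝ)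
    (hPA : IsCoeffs k n A PA) (hPA1 : ∀ t, PA 1 t = 0)
    (hPB : IsCoeffs k n B PB) (hPB1 : ∀ t, PB 1 t = 0)
    (hspan : ∀ t, LinearMap.range (B t).mulVecLin = LinearMap.range (A t).mulVecLin) :
    ∃ X : Matrix (Fin n) (Fin n) ℝ, IsUnit X ∧ ∀ t, B t = A t * X := by
  have hk0 : 0 < k := by omega
  set L := dualBlock k n A ⟨0, hk0⟩
  set X : ℝ → Matrix (Fin n) (Fin n) ℝ := fun t => L t * B t with hX
  have hBX : ∀ t, B t = A t * X t := fun t => hA.eq_mul_dualBlock_mul hk0 (hspan t).le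
  have hXs : MatSmooth X := (hA.matSmooth_dualBlock _).mul hB.1
  have hunit : ∀ t, IsUnit (X t) := fun t => by
    have hAB := hB.eq_mul_dualBlock_mul hk0 (hspan t).ge
    set Y := dualBlock k n B ⟨0, hk0⟩ t * A t
    have h0 : L t * A t = 1 := by
      simpa [dmat] using hA.dualBlock_mul ⟨0, hk0⟩ ⟨0, hk0⟩ t
    have hXY : X t * Y = 1 := by
      rw [hX, Matrix.mul_assoc, ← hAB, h0]
    exact IsUnit.of_mul_eq_one Y hXY
  have hX' : ∀ t, dmat 1 X t = 0 := fun t => by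
    set R := dualBlock k n A ⟨k - 1, by omega⟩ t
    have hRA : ∀ j, j + 1 < k → R * dmat j A t = 0 := fun j hj => by
      rw [hA.dualBlock_mul ⟨k - 1, by omega⟩ ⟨j, by omega⟩ t, if_neg]
      simp only [Fin.mk.injEq]
      omega
    have hR1 : R * dmat (k - 1) A t = 1 := by
      simpa using hA.dualBlock_mul ⟨k - 1, by omega⟩ ⟨k - 1, by omega⟩ t
    have hRAk := hPA.mul_dmat_eq_zero (hPA1 t) hRA
    have hleib : ∀ m, dmat m B t = ∑ i ∈ Finset.range (m + 1),
        (m.choose i : ℝ) • (dmat i A t * dmat (m - i) X t) := fun m => by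
      rw [← dmat_mul hA.1 hXs, ← funext hBX]
    have hRB : ∀ j, j + 1 < k → R * dmat j B t = 0 := fun j hj => by
      rw [hleib, Matrix.mul_sum]
      refine Finset.sum_eq_zero fun i hi => ?_
      rw [Finset.mem_range] at hi
      rw [Matrix.mul_smul, ← Matrix.mul_assoc, hRA i (by omega), Matrix.zero_mul, smul_zero]
    have hRBk := hPB.mul_dmat_eq_zero (hPB1 t) hRB
    rw [hleib, Matrix.mul_sum, Finset.sum_eq_single (k - 1), Matrix.mul_smul,
      ← Matrix.mul_assoc, hR1, Matrix.one_mul, Nat.sub_sub_self (by omega)] at hRBk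
    · refine (smul_eq_zero.1 hRBk).resolve_left ?_
      exact_mod_cast (Nat.choose_pos (Nat.sub_le k 1)).ne'
    · intro i hi hne
      rw [Finset.mem_range] at hi
      rw [Matrix.mul_smul, ← Matrix.mul_assoc]
      rcases eq_or_ne i k with rfl | hik
      · rw [hRAk, Matrix.zero_mul, smul_zero]
      · rw [hRA i (by omega), Matrix.zero_mul, smul_zero]
    · intro h
      exact absurd (Finset.mem_range.2 (by omega)) h
  refine ⟨X 0, hunit 0, fun t => ?_⟩
  have hconst : X t = X 0 := by
    ext i j
    refine is_const_of_deriv_eq_zero (f := fun s => X s i j)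
      ((hXs i j).differentiable (by simp)) (fun s => ?_) t 0
    simpa [dmat_apply] using congrFun (congrFun (hX' s) i) j
  rw [hBX t, hconst]
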